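/- Local quadratic approximation of the SCAD penalty: for every a > 2, λ > 0 and every β₀ ≠ 0, the error of the quadratic surrogate is of smaller order than the first-order increment, i.e. p_λ(|β|) − [ p_λ(|β₀|) + (q_λ(|β₀|)/(2|β₀|)) (β² − β₀²) ] = o(|β − β₀|) as β → β₀. -/

import Mathlib

open Asymptotics Filter

/-- The SCAD penalty derivative `q_λ`. -/
noncomputable def scadDeriv (a lam : ℝ) (t : ℝ) : ℝ :=
  if t ≤ lam then lam else max (a * lam - t) 0 / (a - 1)

/-- The SCAD penalty `p_λ`. -/
noncomputable def scadPenalty (a lam : ℝ) (t : ℝ) : ℝ :=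
  if t ≤ lam then lam * t
  else if t ≤ a * lam then (2 * a * lam * t - t ^ 2 - lam ^ 2) / (2 * (a - 1))
  else (a + 1) * lam ^ 2 / 2

/-- Gluing two functions with matching values and derivatives at `c`. -/
theorem hasDerivAt_ite_le {f g f' g' : ℝ → ℝ} {c : ℝ}
    (hf : ∀ t ≤ c, HasDerivAt f (f' t) t) (hg : ∀ t, c ≤ t → HasDerivAt g (g' t) t)
    (hval : f c = g c) (hder : f' c = g' c) (t : ℝ) :
    HasDerivAt (fun t => if t ≤ c then f t else g t) (if t ≤ c then f' t else g' t) t := by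
  rcases lt_trichotomy t c with h | rfl | h
  · rw [if_pos h.le]
    refine (hf t h.le).congr_of_eventuallyEq ?_
    filter_upwards [Iio_mem_nhds h] with x hx
    exact if_pos (le_of_lt hx)
  · rw [if_pos le_rfl]
    have hl : HasDerivWithinAt (fun x => if x ≤ t then f x else g x) (f' t) (Set.Iic t) t :=
      (hf t le_rfl).hasDerivWithinAt.congr (fun x hx => if_pos hx) (if_pos le_rfl)
    have hr : HasDerivWithinAt (fun x => if x ≤ t then f x else g x) (f' t) (Set.Ici t) t := by
      rw [hder]
      refine (hg t le_rfl).hasDerivWithinAt.congr (fun x hx => ?_) ((if_pos le_rfl).trans hval)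
      rcases (Set.mem_Ici.mp hx).eq_or_lt with rfl | hlt
      · exact (if_pos le_rfl).trans hval
      · exact if_neg hlt.not_ge
    simpa only [Set.Iic_union_Ici, hasDerivWithinAt_univ] using hl.union hr
  · rw [if_neg h.not_ge]
    refine (hg t h.le).congr_of_eventuallyEq ?_
    filter_upwards [Ioi_mem_nhds h] with x hx
    exact if_neg (not_le.mpr hx)

theorem hasDerivAt_scadPenalty {a lam : ℝ} (ha : 1 < a) (hlam : 0 < lam) (t : ℝ) :
    HasDerivAt (scadPenalty a lam) (scadDeriv a lam t) t := by
  have ha' : a - 1 ≠ 0 := by linarith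
  have hle : lam ≤ a * lam := by nlinarith
  have hquad (t : ℝ) : HasDerivAt
      (fun t => (2 * a * lam * t - t ^ 2 - lam ^ 2) / (2 * (a - 1)))
      ((a * lam - t) / (a - 1)) t := by
    have h := ((((hasDerivAt_id t).const_mul (2 * a * lam)).sub
      ((hasDerivAt_id t).pow 2)).sub_const (lam ^ 2)).div_const (2 * (a - 1))
    refine h.congr_deriv ?_
    simp only [id, Nat.cast_ofNat]
    field_simp
    ring
  have houter (t : ℝ) : HasDerivAt
      (fun t => if t ≤ a * lam then (2 * a * lam * t - t ^ 2 - lam ^ 2) / (2 * (a - 1))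
        else (a + 1) * lam ^ 2 / 2)
      (max (a * lam - t) 0 / (a - 1)) t := by
    refine (hasDerivAt_ite_le (c := a * lam) (g' := fun _ => 0) (fun t _ => hquad t)
      (fun t _ => hasDerivAt_const t ((a + 1) * lam ^ 2 / 2)) ?_ ?_ t).congr_deriv ?_
    · field_simp
      ring
    · simp
    · split_ifs with h
      · rw [max_eq_left (by linarith)]
      · rw [max_eq_right (by linarith), zero_div]
  refine hasDerivAt_ite_le (f := fun t => lam * t) (f' := fun _ => lam)
    (fun t _ => by simpa using (hasDerivAt_id t).const_mul lam) (fun t _ => houter t) ?_ ?_ t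
  · simp only [if_pos hle]
    field_simp
    ring
  · rw [max_eq_left (by linarith)]
    field_simp

/-- Local quadratic approximation of the SCAD penalty: for every `a > 2`, `λ > 0`
and every `β₀ ≠ 0`,
`p_λ(|β|) − [p_λ(|β₀|) + (q_λ(|β₀|)/(2|β₀|))(β² − β₀²)] = o(|β − β₀|)` as `β → β₀`. -/
theorem scad_local_quadratic_approximation (a lam : ℝ) (ha : 2 < a) (hlam : 0 < lam)
    (β₀ : ℝ) (hβ₀ : β₀ ≠ 0) :
    (fun β : ℝ => scadPenalty a lam |β| -
        (scadPenalty a lam |β₀| +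
          scadDeriv a lam |β₀| / (2 * |β₀|) * (β ^ 2 - β₀ ^ 2)))
      =o[nhds β₀] (fun β : ℝ => |β - β₀|) := by
  have habs := (hasDerivAt_scadPenalty (by linarith : 1 < a) hlam |β₀|).comp β₀
    (hasDerivAt_abs hβ₀)
  have hsurr := (((hasDerivAt_id β₀).pow 2).sub_const (β₀ ^ 2)).const_mul
    (scadDeriv a lam |β₀| / (2 * |β₀|)) |>.const_add (scadPenalty a lam |β₀|)
  have hslope : scadDeriv a lam |β₀| / (2 * |β₀|) * (2 * β₀) =
      scadDeriv a lam |β₀| * (SignType.sign β₀ : ℝ) := by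
    have hne : |β₀| ≠ 0 := abs_ne_zero.mpr hβ₀
    have hsign : (SignType.sign β₀ : ℝ) * |β₀| = β₀ := sign_mul_abs β₀
    field_simp
    rw [mul_assoc, mul_comm |β₀|, hsign]
  have hdiff := (habs.sub hsurr).isLittleO
  refine (hdiff.congr_left fun β => ?_).norm_right
  simp [hslope]
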